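/- arXiv:1804.06869 — 4 statements merged into one kernel-verified Lean document; each statement's English description precedes it below -/
import Mathlib

section
/- There exists an absolute constant A > 0 such that for every Q > 1, every weight w on [0,1) with dyadic A₂ characteristic [w]_{A₂} ≤ Q, and every dyadic interval J ⊆ [0,1), one has (1/|J|) Σ_{I ∈ D(J)} (Δ_I w^{-1})² ⟨w⟩_I |I| ≤ A Q² ⟨w^{-1}⟩_J. -/
open MeasureTheory

noncomputable section

/-- The dyadic interval `[k/2^n, (k+1)/2^n)`. -/
def dyadicI (n k : ℕ) : Set ℝ := Set.Ico ((k : ℝ) / 2 ^ n) (((k : ℝ) + 1) / 2 ^ n)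

/-- The length of a dyadic interval of generation `n`. -/
def dyadicLen (n : ℕ) : ℝ := 1 / 2 ^ n

/-- The average `⟨f⟩_I` of `f` over the dyadic interval `I = (n,k)`. -/
def avg (f : ℝ → ℝ) (n k : ℕ) : ℝ := (2 : ℝ) ^ n * ∫ x in dyadicI n k, f x

/-- The martingale difference `Δ_I f = ⟨f⟩_{I₊} - ⟨f⟩_{I₋}` for `I = (n,k)`. -/
def haarDiff (f : ℝ → ℝ) (n k : ℕ) : ℝ :=
  avg f (n + 1) (2 * k + 1) - avg f (n + 1) (2 * k)

/-- The Bellman function of the testing estimate. -/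
def bellman (Q u v : ℝ) : ℝ := (2 * Q ^ 2 + Q) * v - v ^ 2 * u - 2 * Q ^ 2 / u

lemma inv_midpoint_gap {a b : ℝ} (ha : 0 < a) (hb : 0 < b) :
    ((b - a) / 2) ^ 2 / ((a + b) / 2) ^ 3 ≤ (1 / a + 1 / b) / 2 - 1 / ((a + b) / 2) := by
  have key : (1 / a + 1 / b) / 2 - 1 / ((a + b) / 2)
      = ((b - a) / 2) ^ 2 / (((a + b) / 2) * (a * b)) := by
    field_simp
    ring
  rw [key]
  apply div_le_div_of_nonneg_left (sq_nonneg _) (by positivity)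
  have : 0 ≤ ((a + b) / 2) * ((b - a) / 2) ^ 2 := by positivity
  nlinarith

lemma bellman_midpoint_gap {Q a b c d : ℝ} (ha : 0 < a) (hb : 0 < b) (hc : 0 < c) (hd : 0 < d)
    (hQ : (a + b) / 2 * ((c + d) / 2) ≤ Q) :
    (d - c) ^ 2 * ((a + b) / 2) ≤
      8 * (bellman Q ((a + b) / 2) ((c + d) / 2) - (bellman Q a c + bellman Q b d) / 2) := by
  have h1 := inv_midpoint_gap ha hb
  have hu : 0 < (a + b) / 2 := by positivity
  have hv : 0 < (c + d) / 2 := by positivity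
  have hQ2 : ((a + b) / 2 * ((c + d) / 2)) ^ 2 ≤ Q ^ 2 := by gcongr
  have h2 : ((a + b) / 2 * ((c + d) / 2)) ^ 2 * (((b - a) / 2) ^ 2 / ((a + b) / 2) ^ 3) ≤
      Q ^ 2 * ((1 / a + 1 / b) / 2 - 1 / ((a + b) / 2)) :=
    mul_le_mul hQ2 h1 (by positivity) (by positivity)
  have h3 : ((a + b) / 2 * ((c + d) / 2)) ^ 2 * (((b - a) / 2) ^ 2 / ((a + b) / 2) ^ 3) =
      ((c + d) / 2) ^ 2 * ((b - a) / 2) ^ 2 / ((a + b) / 2) := by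
    field_simp
  have h4 : 0 ≤ ((a + b) / 2 * ((d - c) / 2) + 2 * ((c + d) / 2) * ((b - a) / 2)) ^ 2
      / (2 * ((a + b) / 2)) := by positivity
  have h5 : ((a + b) / 2 * ((d - c) / 2) + 2 * ((c + d) / 2) * ((b - a) / 2)) ^ 2
      / (2 * ((a + b) / 2)) = (a + b) / 2 * ((d - c) / 2) ^ 2 / 2
      + 2 * ((c + d) / 2) * ((d - c) / 2) * ((b - a) / 2)
      + 2 * (((c + d) / 2) ^ 2 * ((b - a) / 2) ^ 2 / ((a + b) / 2)) := by
    field_simp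
    ring
  have h6 : bellman Q ((a + b) / 2) ((c + d) / 2) - (bellman Q a c + bellman Q b d) / 2 =
      (a + b) / 2 * ((d - c) / 2) ^ 2 + 2 * ((c + d) / 2) * ((d - c) / 2) * ((b - a) / 2)
      + 2 * (Q ^ 2 * ((1 / a + 1 / b) / 2 - 1 / ((a + b) / 2))) := by
    unfold bellman
    ring
  rw [h6]
  rw [h3] at h2
  rw [h5] at h4
  linarith

lemma bellman_nonneg {Q u v : ℝ} (hv : 0 < v) (h1 : 1 / u ≤ v) (hQ : u * v ≤ Q) :
    0 ≤ bellman Q u v := by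
  have h2 : v ^ 2 * u ≤ Q * v := by nlinarith
  have h3 : 2 * Q ^ 2 / u ≤ 2 * Q ^ 2 * v := by
    rw [div_eq_mul_one_div]
    gcongr
  unfold bellman
  linarith

lemma bellman_le {Q u v : ℝ} (hu : 0 < u) (hv : 0 < v) (hQ : 1 < Q) :
    bellman Q u v ≤ 3 * Q ^ 2 * v := by
  have h2 : 0 ≤ v ^ 2 * u := by positivity
  have h3 : 0 ≤ 2 * Q ^ 2 / u := by positivity
  have h4 : Q * v ≤ Q ^ 2 * v := by gcongr; nlinarith
  unfold bellman
  linarith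

lemma sum_range_two_mul_pairs (f : ℕ → ℝ) (m : ℕ) :
    ∑ r ∈ Finset.range (2 * m), f r = ∑ r ∈ Finset.range m, (f (2 * r) + f (2 * r + 1)) := by
  induction m with
  | zero => simp
  | succ m ih =>
    rw [Finset.sum_range_succ, ← ih, show 2 * (m + 1) = 2 * m + 1 + 1 by ring,
      Finset.sum_range_succ, Finset.sum_range_succ]
    ring

lemma dyadicI_subset {n k : ℕ} (hk : k < 2 ^ n) : dyadicI n k ⊆ Set.Ico (0 : ℝ) 1 := by
  have h : (k : ℝ) + 1 ≤ 2 ^ n := by exact_mod_cast hk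
  apply Set.Ico_subset_Ico (by positivity)
  rw [div_le_one (by positivity)]
  exact h

lemma volume_real_dyadicI (n k : ℕ) : volume.real (dyadicI n k) = 1 / 2 ^ n := by
  unfold dyadicI
  rw [Real.volume_real_Ico_of_le (by gcongr; linarith)]
  ring

lemma dyadicI_eq_union (n k : ℕ) :
    dyadicI n k = dyadicI (n + 1) (2 * k) ∪ dyadicI (n + 1) (2 * k + 1) := by
  have e1 : (((2 * k : ℕ) : ℝ)) / 2 ^ (n + 1) = k / 2 ^ n := by
    push_cast; rw [pow_succ]; field_simp
  have e2 : (((2 * k + 1 : ℕ) : ℝ) + 1) / 2 ^ (n + 1) = (k + 1) / 2 ^ n := by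
    push_cast; rw [pow_succ]; field_simp; ring
  have e3 : (((2 * k + 1 : ℕ) : ℝ)) = ((2 * k : ℕ) : ℝ) + 1 := by push_cast; ring
  unfold dyadicI
  rw [e1, e2, e3, Set.Ico_union_Ico_eq_Ico]
  · rw [← e1]; gcongr; linarith
  · rw [← e2, e3]; gcongr; linarith

lemma avg_eq_midpoint {f : ℝ → ℝ} (hf : IntegrableOn f (Set.Ico (0 : ℝ) 1)) {n k : ℕ}
    (hk : k < 2 ^ n) :
    avg f n k = (avg f (n + 1) (2 * k) + avg f (n + 1) (2 * k + 1)) / 2 := by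
  have hint := hf.mono_set (dyadicI_subset hk)
  rw [dyadicI_eq_union] at hint
  have hdisj : Disjoint (dyadicI (n + 1) (2 * k)) (dyadicI (n + 1) (2 * k + 1)) := by
    rw [Set.disjoint_left]
    intro x hx hx'
    have h1 := hx.2
    have h2 := hx'.1
    push_cast at h1 h2
    linarith
  unfold avg
  rw [dyadicI_eq_union n k, setIntegral_union hdisj measurableSet_Ico
    (hint.mono_set Set.subset_union_left) (hint.mono_set Set.subset_union_right)]
  ring

lemma avg_pos {f : ℝ → ℝ} (hf : IntegrableOn f (Set.Ico (0 : ℝ) 1))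
    (hpos : ∀ x ∈ Set.Ico (0 : ℝ) 1, 0 < f x) {n k : ℕ} (hk : k < 2 ^ n) : 0 < avg f n k := by
  have hsub := dyadicI_subset hk
  unfold avg
  apply mul_pos (by positivity)
  rw [setIntegral_pos_iff_support_of_nonneg_ae _ (hf.mono_set hsub)]
  · have : Function.support f ∩ dyadicI n k = dyadicI n k :=
      Set.inter_eq_right.2 fun x hx => (hpos x (hsub hx)).ne'
    rw [this]
    have hv := volume_real_dyadicI n k
    have : 0 < volume.real (dyadicI n k) := by rw [hv]; positivity
    exact (ENNReal.toReal_pos_iff.1 this).1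
  · exact (ae_restrict_iff' measurableSet_Ico).2 (.of_forall fun x hx => (hpos x (hsub hx)).le)

lemma one_div_avg_le_avg_inv {w : ℝ → ℝ} (hw : IntegrableOn w (Set.Ico (0 : ℝ) 1))
    (hw' : IntegrableOn (fun x => (w x)⁻¹) (Set.Ico (0 : ℝ) 1))
    (hpos : ∀ x ∈ Set.Ico (0 : ℝ) 1, 0 < w x) {n k : ℕ} (hk : k < 2 ^ n) :
    1 / avg w n k ≤ avg (fun x => (w x)⁻¹) n k := by
  have hsub := dyadicI_subset hk
  have hu := avg_pos hw hpos hk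
  set c := 1 / avg w n k with hc
  have hfin : volume (dyadicI n k) ≠ ⊤ := by simp [dyadicI]
  have hconst : IntegrableOn (fun _ : ℝ => 2 * c) (dyadicI n k) := integrableOn_const hfin
  have hcw : IntegrableOn (fun x => c ^ 2 * w x) (dyadicI n k) :=
    (hw.mono_set hsub).const_mul _
  have h : ∫ x in dyadicI n k, (2 * c - c ^ 2 * w x) ≤ ∫ x in dyadicI n k, (w x)⁻¹ := by
    apply setIntegral_mono_on (hconst.sub hcw) (hw'.mono_set hsub) measurableSet_Ico
    intro x hx
    have hx0 := hpos x (hsub hx)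
    have h2 : 0 ≤ w x * ((w x)⁻¹ - c) ^ 2 := by positivity
    have h3 : w x * ((w x)⁻¹ - c) ^ 2 = (w x)⁻¹ - (2 * c - c ^ 2 * w x) := by
      field_simp
      ring
    simp only [Pi.sub_apply]
    linarith
  rw [integral_sub hconst hcw, setIntegral_const, integral_const_mul, volume_real_dyadicI,
    smul_eq_mul] at h
  have h4 := mul_le_mul_of_nonneg_left h (show (0 : ℝ) ≤ 2 ^ n by positivity)
  have h5 : (2 : ℝ) ^ n * (1 / 2 ^ n * (2 * c) - c ^ 2 * ∫ x in dyadicI n k, w x)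
      = 2 * c - c ^ 2 * avg w n k := by
    unfold avg
    field_simp
  have h6 : 2 * c - c ^ 2 * avg w n k = c := by
    rw [hc]
    field_simp
    ring
  rw [h5, h6] at h4
  exact h4

lemma two_pow_mul_add_lt {n k p r : ℕ} (hk : k < 2 ^ n) (hr : r < 2 ^ p) :
    2 ^ p * k + r < 2 ^ (n + p) := by
  calc 2 ^ p * k + r < 2 ^ p * (k + 1) := by rw [mul_add, mul_one]; omega
    _ ≤ 2 ^ p * 2 ^ n := Nat.mul_le_mul_left _ hk
    _ = 2 ^ (n + p) := by ring

/-- there is an absolute constant `A > 0` such that for every `Q > 1`, every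
weight `w` on `[0,1)` with dyadic `A₂` characteristic at most `Q`, and every dyadic interval
`J = (n,k)`, the testing sum `(1/|J|) Σ_{I ∈ D(J)} (Δ_I w⁻¹)² ⟨w⟩_I |I|` is at most
`A Q² ⟨w⁻¹⟩_J`.  (The sum over `D(J)` is expressed through all its finite partial sums over
generations `p < N`.) -/
theorem testing_estimate_squareFunction :
    ∃ A : ℝ, 0 < A ∧
      ∀ Q : ℝ, 1 < Q →
      ∀ w : ℝ → ℝ, Measurable w →
        (∀ x ∈ Set.Ico (0 : ℝ) 1, 0 < w x) →
        IntegrableOn w (Set.Ico (0 : ℝ) 1) →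
        IntegrableOn (fun x => (w x)⁻¹) (Set.Ico (0 : ℝ) 1) →
        (∀ n k : ℕ, k < 2 ^ n →
          avg w n k * avg (fun x => (w x)⁻¹) n k ≤ Q) →
        ∀ n k : ℕ, k < 2 ^ n → ∀ N : ℕ,
          (1 / dyadicLen n) *
            ∑ p ∈ Finset.range N, ∑ r ∈ Finset.range (2 ^ p),
              (haarDiff (fun x => (w x)⁻¹) (n + p) (2 ^ p * k + r)) ^ 2 *
                avg w (n + p) (2 ^ p * k + r) * dyadicLen (n + p)
          ≤ A * Q ^ 2 * avg (fun x => (w x)⁻¹) n k := by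
  refine ⟨24, by norm_num, ?_⟩
  intro Q hQ w _ hpos hw hw' hA n k hk N
  have hpos' : ∀ x ∈ Set.Ico (0 : ℝ) 1, 0 < (w x)⁻¹ := fun x hx => inv_pos.2 (hpos x hx)
  set v : ℝ → ℝ := fun x => (w x)⁻¹ with hv
  let B : ℕ → ℕ → ℝ := fun m j => bellman Q (avg w m j) (avg v m j)
  have hchild : ∀ {m j : ℕ}, j < 2 ^ m → 2 * j < 2 ^ (m + 1) ∧ 2 * j + 1 < 2 ^ (m + 1) := by
    intro m j hj
    rw [pow_succ]
    omega
  have hstep : ∀ m j : ℕ, j < 2 ^ m → haarDiff v m j ^ 2 * avg w m j ≤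
      8 * (B m j - (B (m + 1) (2 * j) + B (m + 1) (2 * j + 1)) / 2) := by
    intro m j hj
    obtain ⟨h0, h1⟩ := hchild hj
    have hm := hA m j hj
    simp only [B, haarDiff]
    rw [avg_eq_midpoint hw hj, avg_eq_midpoint hw' hj] at hm ⊢
    exact bellman_midpoint_gap (avg_pos hw hpos h0) (avg_pos hw hpos h1)
      (avg_pos hw' hpos' h0) (avg_pos hw' hpos' h1) hm
  have hB : ∀ m j : ℕ, j < 2 ^ m → 0 ≤ B m j := fun m j hj =>
    bellman_nonneg (avg_pos hw' hpos' hj)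
      (one_div_avg_le_avg_inv hw hw' hpos hj) (hA m j hj)
  have hsum : ∀ N : ℕ, (∑ p ∈ Finset.range N, ∑ r ∈ Finset.range (2 ^ p),
        haarDiff v (n + p) (2 ^ p * k + r) ^ 2 * avg w (n + p) (2 ^ p * k + r) *
          dyadicLen (n + p))
      + 8 * dyadicLen (n + N) * ∑ r ∈ Finset.range (2 ^ N), B (n + N) (2 ^ N * k + r)
      ≤ 8 * dyadicLen n * B n k := by
    intro N
    induction N with
    | zero => simp
    | succ N ih =>
      refine le_trans ?_ ih
      rw [Finset.sum_range_succ, add_assoc]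
      gcongr
      rw [pow_succ', sum_range_two_mul_pairs, Finset.mul_sum, Finset.mul_sum,
        ← Finset.sum_add_distrib]
      apply Finset.sum_le_sum
      intro r hr
      have hs := hstep (n + N) (2 ^ N * k + r) (two_pow_mul_add_lt hk (Finset.mem_range.1 hr))
      have hl : 0 ≤ dyadicLen (n + N) := by unfold dyadicLen; positivity
      have hl' : dyadicLen (n + (N + 1)) = dyadicLen (n + N) / 2 := by
        unfold dyadicLen
        rw [← add_assoc, pow_succ]
        field_simp
      have hm := mul_le_mul_of_nonneg_right hs hl
      rw [hl', show 2 * 2 ^ N * k + 2 * r = 2 * (2 ^ N * k + r) by ring,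
        show 2 * 2 ^ N * k + (2 * r + 1) = 2 * (2 ^ N * k + r) + 1 by ring, ← add_assoc n N 1]
      linarith
  have hl : 0 < dyadicLen n := by unfold dyadicLen; positivity
  have hrest : 0 ≤ 8 * dyadicLen (n + N) *
      ∑ r ∈ Finset.range (2 ^ N), B (n + N) (2 ^ N * k + r) := by
    apply mul_nonneg
    · unfold dyadicLen; positivity
    · exact Finset.sum_nonneg fun r hr =>
        hB _ _ (two_pow_mul_add_lt hk (Finset.mem_range.1 hr))
  have hBle : B n k ≤ 3 * Q ^ 2 * avg v n k :=
    bellman_le (avg_pos hw hpos hk) (avg_pos hw' hpos' hk) hQ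
  rw [one_div, inv_mul_le_iff₀ hl]
  calc _ ≤ 8 * dyadicLen n * B n k := by linarith [hsum N]
    _ ≤ 8 * dyadicLen n * (3 * Q ^ 2 * avg v n k) := by gcongr
    _ = _ := by ring
end
end

section
/- There exists an absolute constant c > 0 such that for every Q ≥ 2 there exist a weight w on [0,1) with dyadic A₂ characteristic [w]_{A₂} ≤ Q and a dyadic interval J ⊆ [0,1) with (1/|J|) Σ_{I ∈ D(J)} (Δ_I w^{-1})² ⟨w⟩_I |I| ≥ c Q² ⟨w^{-1}⟩_J; that is, the bound A Q² ⟨w^{-1}⟩_J in the testing estimate for the weighted square function is sharp in its dependence on Q. -/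
open MeasureTheory

noncomputable section

/-- The power weight `x ^ s`, with the value at `0` replaced by `1`. -/
def powerWeight (s : ℝ) : ℝ → ℝ := Function.update (fun x => x ^ s) 0 1

lemma powerWeight_of_ne_zero (s : ℝ) {x : ℝ} (hx : x ≠ 0) : powerWeight s x = x ^ s := by
  simp [powerWeight, hx]

lemma powerWeight_pos (s : ℝ) {x : ℝ} (hx : 0 ≤ x) : 0 < powerWeight s x := by
  rcases hx.eq_or_lt with rfl | h
  · simp [powerWeight]
  · rw [powerWeight_of_ne_zero s h.ne']
    exact Real.rpow_pos_of_pos h s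

lemma measurable_powerWeight (s : ℝ) : Measurable (powerWeight s) := by
  have h : powerWeight s = fun x => if x = 0 then 1 else x ^ s := by
    ext x
    simp [powerWeight, Function.update_apply]
  rw [h]
  exact Measurable.ite (measurableSet_singleton 0) measurable_const (by fun_prop)

lemma powerWeight_ae_eq (s : ℝ) (A : Set ℝ) :
    powerWeight s =ᵐ[volume.restrict A] fun x => x ^ s := by
  refine ae_restrict_of_ae ?_
  filter_upwards [Measure.ae_ne volume (0 : ℝ)] with x hx
  exact powerWeight_of_ne_zero s hx

lemma inv_powerWeight (s : ℝ) {x : ℝ} (hx : 0 ≤ x) :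
    (powerWeight s x)⁻¹ = powerWeight (-s) x := by
  rcases hx.eq_or_lt with rfl | h
  · simp [powerWeight]
  · rw [powerWeight_of_ne_zero s h.ne', powerWeight_of_ne_zero _ h.ne', Real.rpow_neg hx]

lemma nonneg_of_mem_dyadicI {n k : ℕ} {x : ℝ} (hx : x ∈ dyadicI n k) : 0 ≤ x :=
  le_trans (by positivity) hx.1

lemma avg_inv_powerWeight (s : ℝ) (n k : ℕ) :
    avg (fun x => (powerWeight s x)⁻¹) n k = avg (powerWeight (-s)) n k := by
  unfold avg
  congr 1
  refine setIntegral_congr_fun measurableSet_Ico fun x hx => ?_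
  exact inv_powerWeight s (nonneg_of_mem_dyadicI hx)

lemma integrableOn_powerWeight {s : ℝ} (hs : -1 < s) :
    IntegrableOn (powerWeight s) (Set.Ico 0 1) := by
  have h := intervalIntegral.intervalIntegrable_rpow' (a := 0) (b := 1) hs
  rw [intervalIntegrable_iff_integrableOn_Ico_of_le zero_le_one] at h
  exact h.congr (powerWeight_ae_eq s _).symm

lemma avg_powerWeight {s : ℝ} (hs : -1 < s) (n k : ℕ) :
    avg (powerWeight s) n k = 2 ^ n *
      (((((k : ℝ) + 1) / 2 ^ n) ^ (s + 1) - ((k : ℝ) / 2 ^ n) ^ (s + 1)) / (s + 1)) := by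
  unfold avg
  have hle : (k : ℝ) / 2 ^ n ≤ ((k : ℝ) + 1) / 2 ^ n := by gcongr; linarith
  rw [integral_congr_ae (powerWeight_ae_eq s _), dyadicI, integral_Ico_eq_integral_Ioc,
    ← intervalIntegral.integral_of_le hle, integral_rpow (Or.inl hs)]

lemma avg_nonneg {f : ℝ → ℝ} {n k : ℕ} (hf : ∀ x ∈ dyadicI n k, 0 ≤ f x) :
    0 ≤ avg f n k :=
  mul_nonneg (by positivity) (setIntegral_nonneg measurableSet_Ico hf)

lemma avg_le {f : ℝ → ℝ} {n k : ℕ} {M : ℝ} (hf : ∀ x ∈ dyadicI n k, ‖f x‖ ≤ M) :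
    avg f n k ≤ M := by
  have hvol : volume.real (dyadicI n k) = (2 ^ n)⁻¹ := by
    have hle : (k : ℝ) / 2 ^ n ≤ ((k : ℝ) + 1) / 2 ^ n := by gcongr; linarith
    rw [dyadicI, Real.volume_real_Ico_of_le hle]
    ring
  have h := norm_setIntegral_le_of_norm_le_const (μ := volume) (s := dyadicI n k)
    (by simp [dyadicI]) hf
  rw [hvol] at h
  have h' := (le_abs_self _).trans h
  unfold avg
  calc (2 : ℝ) ^ n * ∫ x in dyadicI n k, f x ≤ 2 ^ n * (M * (2 ^ n)⁻¹) := by gcongr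
    _ = M := by field_simp

lemma avg_powerWeight_mul_le_two {s : ℝ} (hs₀ : 0 ≤ s) (hs₁ : s ≤ 1) (n : ℕ) {k : ℕ}
    (hk : 1 ≤ k) : avg (powerWeight s) n k * avg (powerWeight (-s)) n k ≤ 2 := by
  have hk' : (1 : ℝ) ≤ k := by exact_mod_cast hk
  have ha : (0 : ℝ) < (k : ℝ) / 2 ^ n := by positivity
  have hb : ((k : ℝ) + 1) / 2 ^ n ≤ 2 * ((k : ℝ) / 2 ^ n) := by
    rw [← mul_div_assoc]; gcongr; linarith
  have h₁ : avg (powerWeight s) n k ≤ (2 * ((k : ℝ) / 2 ^ n)) ^ s := by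
    refine avg_le fun x hx => ?_
    have hx0 : 0 < x := ha.trans_le hx.1
    rw [Real.norm_of_nonneg (powerWeight_pos s hx0.le).le, powerWeight_of_ne_zero s hx0.ne']
    exact Real.rpow_le_rpow hx0.le (hx.2.le.trans hb) hs₀
  have h₂ : avg (powerWeight (-s)) n k ≤ ((k : ℝ) / 2 ^ n) ^ (-s) := by
    refine avg_le fun x hx => ?_
    have hx0 : 0 < x := ha.trans_le hx.1
    rw [Real.norm_of_nonneg (powerWeight_pos _ hx0.le).le, powerWeight_of_ne_zero _ hx0.ne']
    exact Real.rpow_le_rpow_of_nonpos ha hx.1 (by linarith)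
  have h₃ : 0 ≤ avg (powerWeight (-s)) n k :=
    avg_nonneg fun x hx => (powerWeight_pos _ (nonneg_of_mem_dyadicI hx)).le
  calc avg (powerWeight s) n k * avg (powerWeight (-s)) n k
      ≤ (2 * ((k : ℝ) / 2 ^ n)) ^ s * ((k : ℝ) / 2 ^ n) ^ (-s) := by gcongr
    _ = 2 ^ s := by
      rw [Real.mul_rpow zero_le_two ha.le, mul_assoc, ← Real.rpow_add ha]; simp
    _ ≤ 2 ^ (1 : ℝ) := Real.rpow_le_rpow_of_exponent_le one_le_two hs₁
    _ = 2 := Real.rpow_one 2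

lemma avg_powerWeight_zero {s : ℝ} (hs : -1 < s) (n : ℕ) :
    avg (powerWeight s) n 0 = ((2 : ℝ) ^ n)⁻¹ ^ s / (s + 1) := by
  have h : (0 : ℝ) < ((2 : ℝ) ^ n)⁻¹ := by positivity
  rw [avg_powerWeight hs]
  simp only [Nat.cast_zero, zero_add, zero_div, one_div]
  rw [Real.zero_rpow (by linarith), Real.rpow_add_one h.ne']
  field_simp
  ring

lemma two_rpow_le_three_halves {δ : ℝ} (hδ : δ ≤ 1 / 2) : (2 : ℝ) ^ δ ≤ 3 / 2 := by
  calc (2 : ℝ) ^ δ ≤ 2 ^ (1 / 2 : ℝ) := Real.rpow_le_rpow_of_exponent_le one_le_two hδ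
    _ = √2 := (Real.sqrt_eq_rpow 2).symm
    _ ≤ 3 / 2 := by rw [Real.sqrt_le_left (by norm_num)]; norm_num

/-- A lower bound for the Haar differences of `x ^ (δ - 1)` on the intervals `[0, 2 ^ (-n))`. -/
lemma le_haarDiff_sq {δ : ℝ} (hδ₀ : 0 < δ) (hδ : δ ≤ 1 / 2) (n : ℕ) :
    (2 / 3 * (2 ^ n * ((2 : ℝ) ^ n)⁻¹ ^ δ / δ)) ^ 2 ≤
      haarDiff (powerWeight (δ - 1)) n 0 ^ 2 := by
  have ht := two_rpow_le_three_halves hδ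
  have ht0 : (0 : ℝ) < 2 ^ δ := by positivity
  have hv : (0 : ℝ) < ((2 : ℝ) ^ n)⁻¹ ^ δ := by positivity
  have hu : ((2 : ℝ) ^ (n + 1))⁻¹ ^ δ = ((2 : ℝ) ^ n)⁻¹ ^ δ / 2 ^ δ := by
    rw [pow_succ, mul_inv, Real.mul_rpow (by positivity) (by positivity),
      Real.inv_rpow zero_le_two, div_eq_mul_inv]
  have hw : (2 / (2 : ℝ) ^ (n + 1)) ^ δ = ((2 : ℝ) ^ n)⁻¹ ^ δ := by
    congr 1
    rw [pow_succ]
    field_simp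
  have key : haarDiff (powerWeight (δ - 1)) n 0 =
      -((2 * (2 / 2 ^ δ - 1)) * (2 ^ n * ((2 : ℝ) ^ n)⁻¹ ^ δ / δ)) := by
    rw [haarDiff, avg_powerWeight (by linarith), avg_powerWeight (by linarith)]
    simp only [mul_zero, zero_add, Nat.cast_zero, Nat.cast_one, sub_add_cancel, zero_div, one_div,
      one_add_one_eq_two]
    rw [Real.zero_rpow hδ₀.ne', hw, hu, pow_succ]
    field_simp
    ring
  have hc : (2 : ℝ) / 3 ≤ 2 * (2 / 2 ^ δ - 1) := by
    have : (4 : ℝ) / 3 ≤ 2 / 2 ^ δ := by rw [le_div_iff₀ ht0]; linarith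
    linarith
  rw [key, neg_sq]
  gcongr

/-- Each interval `[0, 2 ^ (-n))` with `n ≤ δ⁻¹` contributes at least a multiple of `δ⁻²` to the
testing sum. -/
lemma le_testing_term {δ : ℝ} (hδ₀ : 0 < δ) (hδ : δ ≤ 1 / 2) {n : ℕ} (hn : n * δ ≤ 1) :
    1 / 9 * (δ⁻¹) ^ 2 ≤ haarDiff (powerWeight (δ - 1)) n 0 ^ 2 *
      avg (powerWeight (1 - δ)) n 0 * dyadicLen n := by
  have hb : (0 : ℝ) < ((2 : ℝ) ^ n)⁻¹ := by positivity
  have hv : (1 : ℝ) / 2 ≤ ((2 : ℝ) ^ n)⁻¹ ^ δ := by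
    rw [Real.inv_rpow (by positivity), ← Real.rpow_natCast, ← Real.rpow_mul zero_le_two, one_div]
    gcongr
    calc (2 : ℝ) ^ (n * δ) ≤ 2 ^ (1 : ℝ) := Real.rpow_le_rpow_of_exponent_le one_le_two hn
      _ = 2 := Real.rpow_one 2
  have hd := le_haarDiff_sq hδ₀ hδ n
  rw [avg_powerWeight_zero (by linarith), Real.rpow_sub hb, Real.rpow_one, dyadicLen]
  set v := ((2 : ℝ) ^ n)⁻¹ ^ δ
  have hv0 : 0 < v := by linarith
  have h2 : 0 < 1 - δ + 1 := by linarith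
  calc 1 / 9 * (δ⁻¹) ^ 2 ≤ 4 / 9 * v / 2 * (δ⁻¹) ^ 2 :=
      mul_le_mul_of_nonneg_right (by linarith) (by positivity)
    _ ≤ 4 / 9 * v / (1 - δ + 1) * (δ⁻¹) ^ 2 := by gcongr; linarith
    _ = (2 / 3 * (2 ^ n * v / δ)) ^ 2 * ((2 ^ n)⁻¹ / v / (1 - δ + 1)) * (1 / 2 ^ n) := by
      field_simp
      ring
    _ ≤ _ := by gcongr

/-- there is an absolute constant `c > 0` such that for every `Q ≥ 2` one can
find a weight `w` on `[0,1)` with dyadic `A₂` characteristic at most `Q` and a dyadic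
interval `J = (n,k)` for which the testing sum `(1/|J|) Σ_{I ∈ D(J)} (Δ_I w⁻¹)² ⟨w⟩_I |I|`
is at least `c Q² ⟨w⁻¹⟩_J` (some finite partial sum over generations `p < N` already exceeds
this bound): the testing estimate `A Q² ⟨w⁻¹⟩_J` is sharp in its dependence on `Q`. -/
theorem testing_estimate_squareFunction_sharp :
    ∃ c : ℝ, 0 < c ∧
      ∀ Q : ℝ, 2 ≤ Q →
        ∃ w : ℝ → ℝ, Measurable w ∧
          (∀ x ∈ Set.Ico (0 : ℝ) 1, 0 < w x) ∧
          IntegrableOn w (Set.Ico (0 : ℝ) 1) ∧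
          IntegrableOn (fun x => (w x)⁻¹) (Set.Ico (0 : ℝ) 1) ∧
          (∀ n k : ℕ, k < 2 ^ n →
            avg w n k * avg (fun x => (w x)⁻¹) n k ≤ Q) ∧
          ∃ n k : ℕ, k < 2 ^ n ∧ ∃ N : ℕ,
            c * Q ^ 2 * avg (fun x => (w x)⁻¹) n k ≤
              (1 / dyadicLen n) *
                ∑ p ∈ Finset.range N, ∑ r ∈ Finset.range (2 ^ p),
                  (haarDiff (fun x => (w x)⁻¹) (n + p) (2 ^ p * k + r)) ^ 2 *
                    avg w (n + p) (2 ^ p * k + r) * dyadicLen (n + p) := by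
  refine ⟨1 / 9, by norm_num, fun Q hQ => ?_⟩
  have hQ0 : 0 < Q := by linarith
  obtain ⟨δ, hδ₀, hδ, rfl⟩ : ∃ δ : ℝ, 0 < δ ∧ δ ≤ 1 / 2 ∧ Q = δ⁻¹ :=
    ⟨Q⁻¹, by positivity, by rw [one_div]; gcongr, (inv_inv Q).symm⟩
  have hneg : -(1 - δ) = δ - 1 := by ring
  have hinv : ∀ n k, avg (fun x => (powerWeight (1 - δ) x)⁻¹) n k =
      avg (powerWeight (δ - 1)) n k := fun n k => by rw [avg_inv_powerWeight, hneg]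
  refine ⟨powerWeight (1 - δ), measurable_powerWeight _, fun x hx => powerWeight_pos _ hx.1,
    integrableOn_powerWeight (by linarith), ?_, ?_, 0, 0, by norm_num, ⌈δ⁻¹⌉₊, ?_⟩
  · refine (integrableOn_powerWeight (s := δ - 1) (by linarith)).congr_fun (fun x hx => ?_)
      measurableSet_Ico
    exact (hneg ▸ inv_powerWeight (1 - δ) hx.1).symm
  · intro n k _
    rw [hinv]
    rcases Nat.eq_zero_or_pos k with rfl | hk
    · have hb : (0 : ℝ) < ((2 : ℝ) ^ n)⁻¹ := by positivity
      rw [avg_powerWeight_zero (by linarith), avg_powerWeight_zero (by linarith),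
        div_mul_div_comm, ← Real.rpow_add hb, sub_add_cancel]
      simp only [sub_add_sub_cancel, sub_self, Real.rpow_zero]
      rw [← one_div]
      gcongr
      nlinarith
    · exact (hneg ▸ avg_powerWeight_mul_le_two (by linarith) (by linarith) n hk).trans hQ
  · have hhaar : ∀ n k, haarDiff (fun x => (powerWeight (1 - δ) x)⁻¹) n k =
        haarDiff (powerWeight (δ - 1)) n k := fun n k => by simp only [haarDiff, hinv]
    simp only [hinv, hhaar, mul_zero, zero_add]
    have havg : avg (powerWeight (δ - 1)) 0 0 = δ⁻¹ := by
      rw [avg_powerWeight_zero (by linarith)]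
      simp
    rw [havg]
    calc 1 / 9 * (δ⁻¹) ^ 2 * δ⁻¹ ≤ ⌈δ⁻¹⌉₊ * (1 / 9 * (δ⁻¹) ^ 2) := by
          rw [mul_comm]
          gcongr
          exact Nat.le_ceil _
      _ = ∑ p ∈ Finset.range ⌈δ⁻¹⌉₊, 1 / 9 * (δ⁻¹) ^ 2 := by simp
      _ ≤ ∑ p ∈ Finset.range ⌈δ⁻¹⌉₊, ∑ r ∈ Finset.range (2 ^ p),
          haarDiff (powerWeight (δ - 1)) p r ^ 2 * avg (powerWeight (1 - δ)) p r *
            dyadicLen p := by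
        refine Finset.sum_le_sum fun p hp => ?_
        have hp' : (p : ℝ) < δ⁻¹ := Nat.lt_ceil.mp (Finset.mem_range.mp hp)
        have hpδ : p * δ ≤ 1 := by
          rw [← le_div_iff₀ hδ₀, one_div]
          exact hp'.le
        refine (le_testing_term hδ₀ hδ hpδ).trans ?_
        refine Finset.single_le_sum (f := fun r => haarDiff (powerWeight (δ - 1)) p r ^ 2 *
          avg (powerWeight (1 - δ)) p r * dyadicLen p) (fun r _ => ?_) (by simp)
        have hlen : 0 ≤ dyadicLen p := by unfold dyadicLen; positivity
        exact mul_nonneg (mul_nonneg (sq_nonneg _) (avg_nonneg fun x hx =>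
          (powerWeight_pos _ (nonneg_of_mem_dyadicI hx)).le)) hlen
      _ = _ := by simp [dyadicLen]
end
end

section
/- Let Q > 1 and let O_Q = {(u,v) ∈ ℝ² : u > 0, v > 0, 1 < uv ≤ Q}. If X₊, X₋ and X = (X₊ + X₋)/2 all belong to O_Q, then the whole closed segment with endpoints X₊ and X₋ lies in O_{4Q}; that is, for every t ∈ [0,1], the point t X₊ + (1−t) X₋ belongs to O_{4Q}. -/
noncomputable section

/-- The planar domain `O_Q = {(u,v) : u > 0, v > 0, 1 < uv ≤ Q}`. -/
def ODom (Q : ℝ) : Set (ℝ × ℝ) :=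
  {p | 0 < p.1 ∧ 0 < p.2 ∧ 1 < p.1 * p.2 ∧ p.1 * p.2 ≤ Q}

/-- The superlevel set `{(u, v) : u, v > 0, uv > 1}` is convex. -/
theorem one_lt_mul_of_convex_comb {a b c d t : ℝ} (ha : 0 < a) (hb : 0 < b) (hc : 0 < c)
    (hd : 0 < d) (hab : 1 < a * b) (hcd : 1 < c * d) (ht : t ∈ Set.Icc (0 : ℝ) 1) :
    1 < (t * a + (1 - t) * c) * (t * b + (1 - t) * d) := by
  obtain ⟨ht0, ht1⟩ := ht
  have hcross : 2 < a * d + c * b := by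
    have h : 1 < (a * b) * (c * d) := one_lt_mul_of_lt_of_le hab hcd.le
    have : 0 < a * d + c * b := by positivity
    nlinarith [sq_nonneg (a * d - c * b)]
  have h1 : 0 ≤ t * (1 - t) * (a * d + c * b - 2) :=
    mul_nonneg (mul_nonneg ht0 (sub_nonneg.2 ht1)) (by linarith)
  have h2 : 0 ≤ (1 - t) ^ 2 * (c * d - 1) := mul_nonneg (sq_nonneg _) (by linarith)
  rcases ht0.eq_or_lt with rfl | hpos
  · linarith
  · have h3 : 0 < t ^ 2 * (a * b - 1) := mul_pos (by positivity) (by linarith)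
    linarith

/-- if `X₊, X₋` and their midpoint all belong to `O_Q` (`Q > 1`), then the whole
closed segment with endpoints `X₊, X₋` lies in `O_{4Q}`. -/
theorem segment_lies_in_O4Q (Q : ℝ) (hQ : 1 < Q) (Xp Xm : ℝ × ℝ)
    (hXp : Xp ∈ ODom Q) (hXm : Xm ∈ ODom Q)
    (hmid : ((Xp.1 + Xm.1) / 2, (Xp.2 + Xm.2) / 2) ∈ ODom Q) :
    ∀ t : ℝ, t ∈ Set.Icc (0 : ℝ) 1 →
      (t * Xp.1 + (1 - t) * Xm.1, t * Xp.2 + (1 - t) * Xm.2) ∈ ODom (4 * Q) := by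
  obtain ⟨a, b⟩ := Xp
  obtain ⟨c, d⟩ := Xm
  obtain ⟨ha, hb, hab, -⟩ := hXp
  obtain ⟨hc, hd, hcd, -⟩ := hXm
  obtain ⟨-, -, -, hm⟩ := hmid
  dsimp only at ha hb hab hc hd hcd hm
  rintro t ⟨ht0, ht1⟩
  have comb_pos {x y : ℝ} (hx : 0 < x) (hy : 0 < y) : 0 < t * x + (1 - t) * y := by
    rcases ht0.eq_or_lt with rfl | hpos
    · linarith
    · exact add_pos_of_pos_of_nonneg (mul_pos hpos hx) (mul_nonneg (by linarith) hy.le)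
  have comb_le {x y : ℝ} (hx : 0 < x) (hy : 0 < y) : t * x + (1 - t) * y ≤ x + y :=
    add_le_add (mul_le_of_le_one_left hx.le ht1) (mul_le_of_le_one_left hy.le (by linarith))
  refine ⟨comb_pos ha hc, comb_pos hb hd,
    one_lt_mul_of_convex_comb ha hb hc hd hab hcd ⟨ht0, ht1⟩, ?_⟩
  calc (t * a + (1 - t) * c) * (t * b + (1 - t) * d)
      ≤ (a + c) * (b + d) :=
        mul_le_mul (comb_le ha hc) (comb_le hb hd) (comb_pos hb hd).le (by positivity)
    _ ≤ 4 * Q := by linarith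
end
end

section
/- There exists an absolute constant a₀ > 0 such that for every Q > 1 there exists a function 𝓑_Q : O_{4Q} → ℝ satisfying: (i) 0 ≤ 𝓑_Q(F, f, u, v) ≤ F for all (F, f, u, v) ∈ O_{4Q}; and (ii) for all points X = (F, f, u, v), X₊ = (F₊, f₊, u₊, v₊), X₋ = (F₋, f₋, u₋, v₋) belonging to O_Q with X = (X₊ + X₋)/2, one has 𝓑_Q(X) − (𝓑_Q(X₊) + 𝓑_Q(X₋))/2 ≥ a₀ Q^{-2} (f²/v²) u (v₊ − v₋)². -/
noncomputable section

/-- The domain `O_Q = {(F,f,u,v) ∈ (0,∞)⁴ : f² < F v, 1 < uv < Q}` in `ℝ⁴`. -/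
def ODom4 (Q : ℝ) : Set (ℝ × ℝ × ℝ × ℝ) :=
  {p | 0 < p.1 ∧ 0 < p.2.1 ∧ 0 < p.2.2.1 ∧ 0 < p.2.2.2 ∧
    p.2.1 ^ 2 < p.1 * p.2.2.2 ∧ 1 < p.2.2.1 * p.2.2.2 ∧ p.2.2.1 * p.2.2.2 < Q}

open Real in
/-- Lower bound for the binary entropy deficit. -/
lemma sq_div_three_le_mul_log_add_mul_log {y : ℝ} (h1 : -1 < y) (h2 : y < 1) :
    y ^ 2 / 3 ≤ (1 + y) * log (1 + y) + (1 - y) * log (1 - y) := by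
  wlog hy : 0 ≤ y generalizing y
  · have := this (y := -y) (by linarith) (by linarith) (by linarith)
    simp only [neg_sq, sub_neg_eq_add, ← sub_eq_add_neg] at this
    linarith
  have hlog : 2 * y / (y + 2) ≤ log (1 + y) := le_log_one_add_of_nonneg hy
  have hlog' := one_sub_inv_le_log_of_pos (show 0 < 1 - y by linarith)
  have hplus : (1 + y) * (2 * y / (y + 2)) ≤ (1 + y) * log (1 + y) :=
    mul_le_mul_of_nonneg_left hlog (by linarith)
  have hminus : (1 - y) * (1 - (1 - y)⁻¹) ≤ (1 - y) * log (1 - y) :=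
    mul_le_mul_of_nonneg_left hlog' (by linarith)
  have hne : 1 - y ≠ 0 := by linarith
  have eminus : (1 - y) * (1 - (1 - y)⁻¹) = -y := by
    field_simp
    ring
  have eplus : (1 + y) * (2 * y / (y + 2)) = y + y ^ 2 / (y + 2) := by
    field_simp
    ring
  have hsq : y ^ 2 / 3 ≤ y ^ 2 / (y + 2) := by
    gcongr
    linarith
  linarith

open Real in
lemma sq_log_sub_log_le {x : ℝ} (h1 : -1 < x) (h2 : x < 1) :
    (log (1 + x) - log (1 - x)) ^ 2 ≤ 16 * (x ^ 2 / (1 - x ^ 2)) := by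
  wlog hx : 0 ≤ x generalizing x
  · have := this (x := -x) (by linarith) (by linarith) (by linarith)
    simp only [neg_sq, sub_neg_eq_add, ← sub_eq_add_neg] at this
    rwa [← sub_sq_comm] at this
  have hp : 0 < 1 + x := by linarith
  have hm : 0 < 1 - x := by linarith
  obtain ⟨p, hp0, hpx⟩ : ∃ p : ℝ, 0 < p ∧ p ^ 2 = 1 + x :=
    ⟨√(1 + x), sqrt_pos.2 hp, sq_sqrt hp.le⟩
  obtain ⟨m, hm0, hmx⟩ : ∃ m : ℝ, 0 < m ∧ m ^ 2 = 1 - x :=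
    ⟨√(1 - x), sqrt_pos.2 hm, sq_sqrt hm.le⟩
  have hmp : m ≤ p := by
    refine le_of_sq_le_sq ?_ hp0.le
    linarith
  have hlog : log (1 + x) - log (1 - x) = 2 * log (p / m) := by
    rw [← hpx, ← hmx, log_pow, log_pow, log_div hp0.ne' hm0.ne']
    push_cast
    ring
  have hle : log (p / m) ≤ (p - m) / m := by
    have := log_le_sub_one_of_pos (div_pos hp0 hm0)
    rwa [sub_div, div_self hm0.ne']
  have hnn : 0 ≤ log (p / m) := log_nonneg ((one_le_div hm0).2 hmp)
  have hx2 : x = (p ^ 2 - m ^ 2) / 2 := by linarith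
  have hden : 1 - x ^ 2 = p ^ 2 * m ^ 2 := by rw [hpx, hmx]; ring
  have hsum : p ^ 2 + m ^ 2 = 2 := by linarith
  have hmul : (p - m) ^ 2 * p ^ 2 ≤ 4 * x ^ 2 := by
    have : 4 * x ^ 2 = (p - m) ^ 2 * (p + m) ^ 2 := by rw [hx2]; ring
    rw [this]
    gcongr
    linarith
  rw [hlog]
  calc (2 * log (p / m)) ^ 2 = 4 * log (p / m) ^ 2 := by ring
    _ ≤ 4 * ((p - m) / m) ^ 2 := by gcongr
    _ = 4 * ((p - m) ^ 2 * p ^ 2) / (p ^ 2 * m ^ 2) := by field_simp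
    _ ≤ 4 * (4 * x ^ 2) / (p ^ 2 * m ^ 2) := by gcongr
    _ = 16 * (x ^ 2 / (1 - x ^ 2)) := by rw [hden]; ring

open Real in
lemma sq_div_twelve_le_log_form {x y : ℝ} (hx1 : -1 < x) (hx2 : x < 1) (hy1 : -1 < y)
    (hy2 : y < 1) :
    y ^ 2 / 12 ≤ 16 * (x ^ 2 / (1 - x ^ 2)) +
      ((1 + y) * (log (1 + y) + log (1 + x)) + (1 - y) * (log (1 - y) + log (1 - x))) / 2 := by
  have hent := sq_div_three_le_mul_log_add_mul_log hy1 hy2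
  have hdiff := sq_log_sub_log_le hx1 hx2
  have hpos : 0 < 1 - x ^ 2 := by nlinarith
  have hsum : -(x ^ 2 / (1 - x ^ 2)) ≤ log (1 + x) + log (1 - x) := by
    rw [← log_mul (by linarith) (by linarith), show (1 + x) * (1 - x) = 1 - x ^ 2 by ring]
    convert one_sub_inv_le_log_of_pos hpos using 1
    field_simp
    ring
  have hnn : 0 ≤ x ^ 2 / (1 - x ^ 2) := by positivity
  nlinarith [sq_nonneg (y + 3 * (log (1 + x) - log (1 - x)))]

/-- A function of `(u, v)` which is strictly concave in `v` on the region `1 < u v < 4 Q`. -/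
def carlesonMajorant (Q u v : ℝ) : ℝ :=
  v - 1 / u - v * Real.log (u * v) / (16 * Q)

lemma carlesonMajorant_nonneg {Q u v : ℝ} (hQ : 0 < Q) (hu : 0 < u) (hv : 0 < v)
    (h1 : 1 < u * v) (h2 : u * v < 4 * Q) : 0 ≤ carlesonMajorant Q u v := by
  have hlog := Real.log_le_sub_one_of_pos (mul_pos hu hv)
  have hrw : v - 1 / u = (u * v - 1) / u := by field_simp
  have hle : v * Real.log (u * v) / (16 * Q) ≤ (u * v - 1) / u := by
    rw [div_le_div_iff₀ (by positivity) hu]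
    have : v * Real.log (u * v) ≤ v * (u * v - 1) := by gcongr
    nlinarith
  unfold carlesonMajorant
  linarith

lemma carlesonMajorant_le {Q u v : ℝ} (hQ : 0 < Q) (hu : 0 < u) (hv : 0 < v)
    (h1 : 1 < u * v) : carlesonMajorant Q u v ≤ v := by
  have := Real.log_nonneg h1.le
  have : 0 ≤ v * Real.log (u * v) / (16 * Q) := by positivity
  have : 0 < 1 / u := by positivity
  unfold carlesonMajorant
  linarith

lemma carlesonMajorant_midpoint {Q u v x y : ℝ} (hQ : 0 < Q) (hu : 0 < u) (hv : 0 < v)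
    (h : u * v < Q) (hx1 : -1 < x) (hx2 : x < 1) (hy1 : -1 < y) (hy2 : y < 1) :
    v * y ^ 2 / (192 * Q) ≤ carlesonMajorant Q u v -
      (carlesonMajorant Q (u * (1 + x)) (v * (1 + y)) +
        carlesonMajorant Q (u * (1 - x)) (v * (1 - y))) / 2 := by
  have key := sq_div_twelve_le_log_form hx1 hx2 hy1 hy2
  have hxp : 0 < 1 + x := by linarith
  have hxm : 0 < 1 - x := by linarith
  have hyp : 0 < 1 + y := by linarith
  have hym : 0 < 1 - y := by linarith
  have hpos : 0 < 1 - x ^ 2 := by nlinarith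
  have hx0 : 0 ≤ x ^ 2 / (1 - x ^ 2) := by positivity
  have hinv : (1 / (u * (1 + x)) + 1 / (u * (1 - x))) / 2 - 1 / u =
      1 / u * (x ^ 2 / (1 - x ^ 2)) := by
    rw [show 1 - x ^ 2 = (1 + x) * (1 - x) by ring]
    field_simp
    ring
  have hvQ : v / Q ≤ 1 / u := by
    rw [div_le_div_iff₀ hQ hu]
    linarith
  have hmul := mul_le_mul_of_nonneg_right hvQ hx0
  have hkey := mul_le_mul_of_nonneg_left key (show 0 ≤ v / (16 * Q) by positivity)
  unfold carlesonMajorant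
  rw [Real.log_mul hu.ne' hv.ne', Real.log_mul (mul_pos hu hxp).ne' (mul_pos hv hyp).ne',
    Real.log_mul (mul_pos hu hxm).ne' (mul_pos hv hym).ne', Real.log_mul hu.ne' hxp.ne',
    Real.log_mul hv.ne' hyp.ne', Real.log_mul hu.ne' hxm.ne', Real.log_mul hv.ne' hym.ne']
  generalize Real.log (1 + x) = A at *
  generalize Real.log (1 - x) = B at *
  generalize Real.log (1 + y) = C at *
  generalize Real.log (1 - y) = D at *
  generalize x ^ 2 / (1 - x ^ 2) = w at *
  have e1 : v * y ^ 2 / (192 * Q) = v / (16 * Q) * (y ^ 2 / 12) := by ring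
  have e2 : v / (16 * Q) * (16 * w + ((1 + y) * (C + A) + (1 - y) * (D + B)) / 2) =
      v / Q * w + v / (16 * Q) * (((1 + y) * (C + A) + (1 - y) * (D + B)) / 2) := by ring
  rw [e1]
  refine hkey.trans ?_
  rw [e2]
  refine (add_le_add_left hmul _).trans (le_of_eq ?_)
  rw [← hinv]
  ring

/-- Midpoint convexity of `f² / w`, with the gain coming from a strict decrease of `w`. -/
lemma sq_div_midpoint_gain {f₁ f₂ w₁ w₂ w δ : ℝ} (h₁ : 0 < w₁) (h₂ : 0 < w₂) (hδ : 0 ≤ δ)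
    (h : δ ≤ w - (w₁ + w₂) / 2) :
    ((f₁ + f₂) / 2) ^ 2 / w ^ 2 * δ ≤
      (f₁ ^ 2 / w₁ + f₂ ^ 2 / w₂) / 2 - ((f₁ + f₂) / 2) ^ 2 / w := by
  set f := (f₁ + f₂) / 2 with hf
  have hw : 0 < w := by linarith
  have tangent : ∀ g z : ℝ, 0 < z → 2 * (f / w) * g - (f / w) ^ 2 * z ≤ g ^ 2 / z := by
    intro g z hz
    rw [le_div_iff₀ hz]
    nlinarith [sq_nonneg (f / w * z - g)]
  have t₁ := tangent f₁ w₁ h₁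
  have t₂ := tangent f₂ w₂ h₂
  have hmul := mul_le_mul_of_nonneg_left h (sq_nonneg (f / w))
  have e : f ^ 2 / w = 2 * (f / w) * f - (f / w) ^ 2 * w := by
    field_simp
    ring
  have e' : f ^ 2 / w = (f / w) ^ 2 * w := by field_simp
  have ef : f₂ = 2 * f - f₁ := by rw [hf]; ring
  rw [← div_pow]
  rw [ef] at t₂ ⊢
  nlinarith

/-- there is an absolute constant `a₀ > 0` such that for every `Q > 1` there
is a function `𝓑_Q : O_{4Q} → ℝ` with `0 ≤ 𝓑_Q(F,f,u,v) ≤ F` on `O_{4Q}`, and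
`𝓑_Q(X) − (𝓑_Q(X₊)+𝓑_Q(X₋))/2 ≥ a₀ Q⁻² (f²/v²) u (v₊ − v₋)²`
for all `X, X₊, X₋ ∈ O_Q` with `X = (X₊+X₋)/2`.  Here `X = (F,f,u,v)`. -/
theorem bellman_function_T1_exists :
    ∃ a₀ : ℝ, 0 < a₀ ∧
      ∀ Q : ℝ, 1 < Q →
        ∃ 𝓑 : ℝ × ℝ × ℝ × ℝ → ℝ,
          (∀ X ∈ ODom4 (4 * Q), 0 ≤ 𝓑 X ∧ 𝓑 X ≤ X.1) ∧
          (∀ X Xp Xm : ℝ × ℝ × ℝ × ℝ,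
            X ∈ ODom4 Q → Xp ∈ ODom4 Q → Xm ∈ ODom4 Q →
            X.1 = (Xp.1 + Xm.1) / 2 → X.2.1 = (Xp.2.1 + Xm.2.1) / 2 →
            X.2.2.1 = (Xp.2.2.1 + Xm.2.2.1) / 2 → X.2.2.2 = (Xp.2.2.2 + Xm.2.2.2) / 2 →
            a₀ * Q⁻¹ ^ 2 * (X.2.1 ^ 2 / X.2.2.2 ^ 2) * X.2.2.1 *
                (Xp.2.2.2 - Xm.2.2.2) ^ 2
              ≤ 𝓑 X - (𝓑 Xp + 𝓑 Xm) / 2) := by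
  refine ⟨1 / 3072, by norm_num, fun Q hQ => ?_⟩
  have hQ0 : 0 < Q := by linarith
  refine ⟨fun X => X.1 - X.2.1 ^ 2 / (X.2.2.2 + carlesonMajorant Q X.2.2.1 X.2.2.2), ?_, ?_⟩
  · rintro ⟨F, f, u, v⟩ ⟨hF, hf, hu, hv, hfF, h1, h2⟩
    dsimp only at *
    have hM := carlesonMajorant_nonneg hQ0 hu hv h1 h2
    have hw : 0 < v + carlesonMajorant Q u v := by linarith
    constructor
    · rw [sub_nonneg, div_le_iff₀ hw]
      nlinarith
    · have : 0 ≤ f ^ 2 / (v + carlesonMajorant Q u v) := by positivity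
      linarith
  · rintro ⟨F, f, u, v⟩ ⟨F₁, f₁, u₁, v₁⟩ ⟨F₂, f₂, u₂, v₂⟩ ⟨-, -, hu, hv, -, h1, h2⟩
      ⟨-, -, hu₁, hv₁, -, h11, h12⟩ ⟨-, -, hu₂, hv₂, -, h21, h22⟩ eF ef eu ev
    dsimp only at *
    have hM₁ := carlesonMajorant_nonneg hQ0 hu₁ hv₁ h11 (by linarith)
    have hM₂ := carlesonMajorant_nonneg hQ0 hu₂ hv₂ h21 (by linarith)
    have hM := carlesonMajorant_nonneg hQ0 hu hv h1 (by linarith)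
    have hMle := carlesonMajorant_le hQ0 hu hv h1
    have hmid := carlesonMajorant_midpoint (x := (u₁ - u₂) / (2 * u)) (y := (v₁ - v₂) / (2 * v))
      hQ0 hu hv h2 (by rw [lt_div_iff₀ (by positivity)]; linarith)
      (by rw [div_lt_iff₀ (by positivity)]; linarith)
      (by rw [lt_div_iff₀ (by positivity)]; linarith)
      (by rw [div_lt_iff₀ (by positivity)]; linarith)
    rw [show u * (1 + (u₁ - u₂) / (2 * u)) = u₁ by field_simp; linarith,
      show u * (1 - (u₁ - u₂) / (2 * u)) = u₂ by field_simp; linarith,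
      show v * (1 + (v₁ - v₂) / (2 * v)) = v₁ by field_simp; linarith,
      show v * (1 - (v₁ - v₂) / (2 * v)) = v₂ by field_simp; linarith] at hmid
    have hgain := sq_div_midpoint_gain (f₁ := f₁) (f₂ := f₂)
      (w := v + carlesonMajorant Q u v) (w₁ := v₁ + carlesonMajorant Q u₁ v₁)
      (w₂ := v₂ + carlesonMajorant Q u₂ v₂) (by linarith) (by linarith)
      (by positivity) (hmid.trans (by linarith))
    rw [← ef] at hgain
    have huv : u * Q⁻¹ ≤ v⁻¹ := by
      rw [← div_eq_mul_inv, ← one_div, div_le_div_iff₀ hQ0 hv]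
      linarith
    have hlow : 1 / 3072 * Q⁻¹ ^ 2 * (f ^ 2 / v ^ 2) * u * (v₁ - v₂) ^ 2 ≤
        f ^ 2 / (v + carlesonMajorant Q u v) ^ 2 *
          (v * ((v₁ - v₂) / (2 * v)) ^ 2 / (192 * Q)) := by
      calc 1 / 3072 * Q⁻¹ ^ 2 * (f ^ 2 / v ^ 2) * u * (v₁ - v₂) ^ 2
          = 1 / 3072 * Q⁻¹ * (f ^ 2 / v ^ 2) * (v₁ - v₂) ^ 2 * (u * Q⁻¹) := by ring
        _ ≤ 1 / 3072 * Q⁻¹ * (f ^ 2 / v ^ 2) * (v₁ - v₂) ^ 2 * v⁻¹ := by gcongr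
        _ = f ^ 2 / (v + v) ^ 2 * (v * ((v₁ - v₂) / (2 * v)) ^ 2 / (192 * Q)) := by
          field_simp
          ring
        _ ≤ _ := by gcongr
    linarith
end
end
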